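/- arXiv:2407.07719 — 2 statements merged into one kernel-verified Lean document; each statement's English description precedes it below -/
import Mathlib

section
/- Let E be a real inner product space, let a, x_r ∈ E with x_r ≠ a, set d = ‖x_r − a‖ and u = (x_r − a)/d. Then for every x ∈ E with ‖x − x_r‖ < d, the first-order Taylor error of the propagation distance satisfies 0 ≤ ‖x − a‖ − d − ⟪u, x − x_r⟫ ≤ ‖x − x_r‖² / (2(d − ‖x − x_r‖)). -/
open scoped RealInnerProductSpace

theorem taylor_error_bound (E : Type*) [NormedAddCommGroup E]
    [InnerProductSpace ℝ E] (a xr : E) (h : xr ≠ a) (d : ℝ) (hd : d = ‖xr - a‖)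
    (u : E) (hu : u = d⁻¹ • (xr - a)) :
    ∀ x : E, ‖x - xr‖ < d →
      0 ≤ ‖x - a‖ - d - ⟪u, x - xr⟫ ∧
      ‖x - a‖ - d - ⟪u, x - xr⟫ ≤ ‖x - xr‖ ^ 2 / (2 * (d - ‖x - xr‖)) := by
  intro x hx
  have hd_pos : 0 < d := hd ▸ norm_pos_iff.mpr (sub_ne_zero.mpr h)
  have hu_norm : ‖u‖ = 1 := by
    rw [hu, norm_smul, ← hd, norm_inv, Real.norm_of_nonneg hd_pos.le,
      inv_mul_cancel₀ hd_pos.ne']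
  have h_inner : ⟪xr - a, x - xr⟫ = d * ⟪u, x - xr⟫ := by
    rw [hu, real_inner_smul_left, mul_inv_cancel_left₀ hd_pos.ne']
  have h_abs : |⟪u, x - xr⟫| ≤ ‖x - xr‖ := by
    simpa [hu_norm] using abs_real_inner_le_norm u (x - xr)
  have h_sq : ‖x - a‖ ^ 2 = d ^ 2 + 2 * (d * ⟪u, x - xr⟫) + ‖x - xr‖ ^ 2 := by
    rw [← h_inner, hd, ← norm_add_sq_real, add_comm, sub_add_sub_cancel]
  have h_nonneg := norm_nonneg (x - a)
  generalize ⟪u, x - xr⟫ = c at h_abs h_sq ⊢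
  generalize ‖x - xr‖ = s at hx h_abs h_sq ⊢
  generalize ‖x - a‖ = n at h_sq h_nonneg ⊢
  obtain ⟨hc₁, hc₂⟩ := abs_le.mp h_abs
  have h_gap : 0 < d - s := sub_pos.mpr hx
  constructor
  · have : d + c ≤ n := abs_le_of_sq_le_sq' (by nlinarith) h_nonneg |>.2
    linarith
  · have hK : s ^ 2 / (2 * (d - s)) * (2 * (d - s)) = s ^ 2 :=
      div_mul_cancel₀ _ (by positivity)
    have hK_nonneg : 0 ≤ s ^ 2 / (2 * (d - s)) := by positivity
    generalize s ^ 2 / (2 * (d - s)) = K at hK hK_nonneg ⊢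
    have h_mul : 0 ≤ K * (c + s) := mul_nonneg hK_nonneg (by linarith)
    have : n ≤ d + c + K :=
      abs_le_of_sq_le_sq' (by nlinarith [sq_nonneg c, sq_nonneg K]) (by linarith) |>.2
    linarith
end

section
/- Let E be a real inner product space, let x_r, a, a_r ∈ E with x_r ≠ a and x_r ≠ a_r, set u_j = (x_r − a)/‖x_r − a‖ and u_r = (x_r − a_r)/‖x_r − a_r‖. Let x ∈ E with ‖x − x_r‖ < ‖x_r − a‖ and suppose ‖a − a_r‖ < ‖x_r − a_r‖. Then the two-variable first-order Taylor approximation of the propagation distance satisfies 0 ≤ ‖x − a‖ − (‖x_r − a_r‖ + ⟪u_j, x − x_r⟫ − ⟪u_r, a − a_r⟫) ≤ ‖x − x_r‖²/(2(‖x_r − a‖ − ‖x − x_r‖)) + ‖a − a_r‖²/(2(‖x_r − a_r‖ − ‖a − a_r‖)). -/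
open scoped RealInnerProductSpace

/-- The remainder of the first-order Taylor expansion of the norm of a real inner product space
at `p` is nonnegative and quadratically small in the increment `h`. -/
theorem norm_add_taylor_remainder_bounds {E : Type*} [NormedAddCommGroup E]
    [InnerProductSpace ℝ E] (p h : E) (hph : ‖h‖ < ‖p‖) :
    0 ≤ ‖p + h‖ - (‖p‖ + ⟪‖p‖⁻¹ • p, h⟫) ∧
      ‖p + h‖ - (‖p‖ + ⟪‖p‖⁻¹ • p, h⟫) ≤ ‖h‖ ^ 2 / (2 * (‖p‖ - ‖h‖)) := by
  have hp : 0 < ‖p‖ := (norm_nonneg h).trans_lt hph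
  set t : ℝ := ⟪‖p‖⁻¹ • p, h⟫ with ht
  have hinner : ⟪p, h⟫ = ‖p‖ * t := by
    rw [ht, real_inner_smul_left, mul_inv_cancel_left₀ hp.ne']
  have habs : |t| ≤ ‖h‖ := by
    have hcs := abs_real_inner_le_norm p h
    rw [hinner, abs_mul, abs_of_pos hp] at hcs
    exact le_of_mul_le_mul_left hcs hp
  have hsq : ‖p + h‖ ^ 2 = ‖p‖ ^ 2 + 2 * (‖p‖ * t) + ‖h‖ ^ 2 := by
    rw [norm_add_sq_real, hinner]
  have htsq : t ^ 2 ≤ ‖h‖ ^ 2 := sq_le_sq' (abs_le.mp habs).1 (abs_le.mp habs).2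
  have hlower : ‖p‖ + t ≤ ‖p + h‖ := by
    refine le_of_abs_le (abs_le_of_sq_le_sq ?_ (norm_nonneg _))
    linarith [add_sq ‖p‖ t]
  refine ⟨sub_nonneg.mpr hlower, ?_⟩
  rw [le_div_iff₀ (by linarith)]
  calc (‖p + h‖ - (‖p‖ + t)) * (2 * (‖p‖ - ‖h‖))
      ≤ (‖p + h‖ - (‖p‖ + t)) * (‖p + h‖ + (‖p‖ + t)) :=
        mul_le_mul_of_nonneg_left (by linarith [(abs_le.mp habs).1]) (sub_nonneg.mpr hlower)
    _ = ‖h‖ ^ 2 - t ^ 2 := by linear_combination hsq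
    _ ≤ ‖h‖ ^ 2 := sub_le_self _ (sq_nonneg t)

theorem taylor_two_variable_error_bound (E : Type*) [NormedAddCommGroup E]
    [InnerProductSpace ℝ E] (xr a ar : E) (ha : xr ≠ a) (har : xr ≠ ar)
    (uj ur : E) (huj : uj = (‖xr - a‖)⁻¹ • (xr - a)) (hur : ur = (‖xr - ar‖)⁻¹ • (xr - ar))
    (x : E) (hx : ‖x - xr‖ < ‖xr - a‖) (haa : ‖a - ar‖ < ‖xr - ar‖) :
    0 ≤ ‖x - a‖ - (‖xr - ar‖ + ⟪uj, x - xr⟫ - ⟪ur, a - ar⟫) ∧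
    ‖x - a‖ - (‖xr - ar‖ + ⟪uj, x - xr⟫ - ⟪ur, a - ar⟫) ≤
      ‖x - xr‖ ^ 2 / (2 * (‖xr - a‖ - ‖x - xr‖)) +
      ‖a - ar‖ ^ 2 / (2 * (‖xr - ar‖ - ‖a - ar‖)) := by
  obtain ⟨hlx, hux⟩ := norm_add_taylor_remainder_bounds (xr - a) (x - xr) hx
  obtain ⟨hla, hua⟩ := norm_add_taylor_remainder_bounds (xr - ar) (-(a - ar))
    (by rwa [norm_neg])
  rw [← huj, add_comm (xr - a), sub_add_sub_cancel] at hlx hux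
  rw [← hur, inner_neg_right, ← sub_eq_add_neg, sub_sub_sub_cancel_right] at hla hua
  rw [norm_neg] at hua
  constructor <;> linarith
end
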